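/- The upper-left block of the inverse of the saddle-point matrix satisfies: (a) C*S_Δinv = 0, (b) S_Δinv*S*S_Δinv = S_Δinv, and (c) Ψᵀ*S*S_Δinv = 0; consequently Ψᵀ*S*Φ = Ψᵀ*S*Ψ. -/

import Mathlib

open Matrix

noncomputable section

/-- The saddle-point matrix `K = [[S, Cᵀ], [C, 0]]`. -/
def Kmat {n c : ℕ} (S : Matrix (Fin n) (Fin n) ℝ) (C : Matrix (Fin c) (Fin n) ℝ) :
    Matrix (Fin n ⊕ Fin c) (Fin n ⊕ Fin c) ℝ :=
  fromBlocks S Cᵀ C 0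

/-- `S_Δ⁻¹`, the upper-left `n×n` block of `K⁻¹`. -/
def SDelta {n c : ℕ} (S : Matrix (Fin n) (Fin n) ℝ) (C : Matrix (Fin c) (Fin n) ℝ) :
    Matrix (Fin n) (Fin n) ℝ :=
  ((Kmat S C)⁻¹).toBlocks₁₁

/-- The energy-minimal coarse basis `Ψ = (I − S_Δ⁻¹ S) Φ`. -/
def Psi {n c q : ℕ} (S : Matrix (Fin n) (Fin n) ℝ) (C : Matrix (Fin c) (Fin n) ℝ)
    (Φ : Matrix (Fin n) (Fin q) ℝ) : Matrix (Fin n) (Fin q) ℝ :=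
  (1 - SDelta S C * S) * Φ

/-- The coarse matrix `S_c = Φᵀ S Φ − [S Φ; 0]ᵀ K⁻¹ [S Φ; 0]`. -/
def Sc {n c q : ℕ} (S : Matrix (Fin n) (Fin n) ℝ) (C : Matrix (Fin c) (Fin n) ℝ)
    (Φ : Matrix (Fin n) (Fin q) ℝ) : Matrix (Fin q) (Fin q) ℝ :=
  Φᵀ * S * Φ -
    (fromRows (S * Φ) (0 : Matrix (Fin c) (Fin q) ℝ))ᵀ * (Kmat S C)⁻¹ *
      fromRows (S * Φ) (0 : Matrix (Fin c) (Fin q) ℝ)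

end

theorem isSymm_SDelta {n c : ℕ} {S : Matrix (Fin n) (Fin n) ℝ} (hS : Sᵀ = S)
    (C : Matrix (Fin c) (Fin n) ℝ) : (SDelta S C)ᵀ = SDelta S C := by
  have hK : (Kmat S C)ᵀ = Kmat S C := by
    simp [Kmat, fromBlocks_transpose, hS]
  have hinv : ((Kmat S C)⁻¹)ᵀ = (Kmat S C)⁻¹ := by
    rw [transpose_nonsing_inv, hK]
  exact congrArg toBlocks₁₁ hinv

theorem Kmat_inv_block_identities {n c : ℕ} {S : Matrix (Fin n) (Fin n) ℝ}
    {C : Matrix (Fin c) (Fin n) ℝ} (hK : IsUnit (Kmat S C)) :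
    C * SDelta S C = 0 ∧ SDelta S C * S + (Kmat S C)⁻¹.toBlocks₁₂ * C = 1 := by
  have hdet : IsUnit (Kmat S C).det := (isUnit_iff_isUnit_det _).mp hK
  have hr := mul_nonsing_inv _ hdet
  have hl := nonsing_inv_mul _ hdet
  rw [← fromBlocks_toBlocks (Kmat S C)⁻¹, ← fromBlocks_one] at hr hl
  nth_rw 1 [Kmat] at hr
  nth_rw 5 [Kmat] at hl
  rw [fromBlocks_multiply, fromBlocks_inj] at hr hl
  exact ⟨by simpa [SDelta] using hr.2.2.1, hl.1⟩

theorem stmt_17 {n c q : ℕ} (hn : 0 < n) (hc : 0 < c) (hq : 0 < q)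
    (S : Matrix (Fin n) (Fin n) ℝ) (hS : Sᵀ = S)
    (C : Matrix (Fin c) (Fin n) ℝ) (hK : IsUnit (Kmat S C))
    (Φ : Matrix (Fin n) (Fin q) ℝ) (R_c : Matrix (Fin c) (Fin q) ℝ) (hCΦ : C * Φ = R_c) :
    C * SDelta S C = 0 ∧
    SDelta S C * S * SDelta S C = SDelta S C ∧
    (Psi S C Φ)ᵀ * S * SDelta S C = 0 ∧
    (Psi S C Φ)ᵀ * S * Φ = (Psi S C Φ)ᵀ * S * Psi S C Φ := by
  obtain ⟨hCA, hAS⟩ := Kmat_inv_block_identities hK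
  have hASA : SDelta S C * S * SDelta S C = SDelta S C := by
    rw [eq_sub_of_add_eq hAS, Matrix.sub_mul, Matrix.mul_assoc, hCA]
    simp
  have hΨ : (Psi S C Φ)ᵀ * S * SDelta S C = 0 := by
    have h : (1 - S * SDelta S C) * (S * SDelta S C) = 0 := by
      rw [Matrix.sub_mul, Matrix.one_mul, Matrix.mul_assoc, ← Matrix.mul_assoc (SDelta S C),
        hASA, sub_self]
    rw [Psi, transpose_mul, transpose_sub, transpose_mul, transpose_one, hS,
      isSymm_SDelta hS, Matrix.mul_assoc, Matrix.mul_assoc, h, Matrix.mul_zero]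
  refine ⟨hCA, hASA, hΨ, ?_⟩
  have h : Psi S C Φ = Φ - SDelta S C * (S * Φ) := by
    rw [Psi, Matrix.sub_mul, Matrix.one_mul, Matrix.mul_assoc]
  nth_rw 3 [h]
  rw [Matrix.mul_sub, ← Matrix.mul_assoc _ (SDelta S C), hΨ, Matrix.zero_mul, sub_zero]
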